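/- arXiv:1601.02226 — 6 statements merged into one kernel-verified Lean document; each statement's English description precedes it below -/
import Mathlib

section
/- For every nonzero x ∈ ℂ³ with ρ(x) = 0 and f(x) ≠ (0,0,0), there exists a nonzero λ ∈ ℂ such that f(x) = λ·x. (This expresses that the rational map f of ℙ² fixes every non-indeterminate point of the conic Q = {ρ = 0} pointwise.) -/
/-- ρ(x) = x₁² + x₂² + x₃² − 2(x₁x₂ + x₂x₃ + x₃x₁) -/
def rho (x : ℂ × ℂ × ℂ) : ℂ :=
  x.1 ^ 2 + x.2.1 ^ 2 + x.2.2 ^ 2 - 2 * (x.1 * x.2.1 + x.2.1 * x.2.2 + x.2.2 * x.1)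
/-- ρ₁(x) = −x₁ + x₂ + x₃ -/
def rho1 (x : ℂ × ℂ × ℂ) : ℂ := -x.1 + x.2.1 + x.2.2
/-- ρ₂(x) = x₁ − x₂ + x₃ -/
def rho2 (x : ℂ × ℂ × ℂ) : ℂ := x.1 - x.2.1 + x.2.2
/-- ρ₃(x) = x₁ + x₂ − x₃ -/
def rho3 (x : ℂ × ℂ × ℂ) : ℂ := x.1 + x.2.1 - x.2.2
/-- Homogeneous representative of the rational map f = g∘h. -/
def fmap (x : ℂ × ℂ × ℂ) : ℂ × ℂ × ℂ :=
  (x.1 ^ 2 * rho1 x ^ 2, x.2.1 ^ 2 * rho2 x ^ 2, x.2.2 ^ 2 * rho3 x ^ 2)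

/-- Every non-indeterminate point of the conic Q = {ρ = 0} is fixed by f. -/
theorem stmt_5 (x : ℂ × ℂ × ℂ) (hx : x ≠ 0) (hρ : rho x = 0)
    (hf : fmap x ≠ (0, 0, 0)) :
    ∃ lam : ℂ, lam ≠ 0 ∧ fmap x = lam • x := by
  have h : fmap x = (4 * x.1 * x.2.1 * x.2.2) • x := by
    obtain ⟨a, b, c⟩ := x
    simp only [rho] at hρ
    simp only [fmap, rho1, rho2, rho3, Prod.smul_mk, smul_eq_mul, Prod.mk.injEq]
    refine ⟨?_, ?_, ?_⟩
    · linear_combination a ^ 2 * hρ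
    · linear_combination b ^ 2 * hρ
    · linear_combination c ^ 2 * hρ
  refine ⟨4 * x.1 * x.2.1 * x.2.2, ?_, h⟩
  intro h0
  apply hf
  rw [h, h0, zero_smul]
  rfl
end

section
/- The point (1,1) is a fixed point of the map F, and the (total) derivative of F at (1,1) equals −2 times the identity map of ℝ²; in particular both eigenvalues of DF(1,1) have modulus 2 > 1, so the fixed point [1:1:1] of the rational map f of ℙ² is repelling. -/
/-- Affine-chart representation of f = g∘h. -/
noncomputable def F (p : ℝ × ℝ) : ℝ × ℝ :=
  (p.1 ^ 2 * (-p.1 + p.2 + 1) ^ 2 / (p.1 + p.2 - 1) ^ 2,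
   p.2 ^ 2 * (p.1 - p.2 + 1) ^ 2 / (p.1 + p.2 - 1) ^ 2)

/-- (1,1) is a fixed point of F and DF(1,1) = −2·Id, so the fixed point
[1:1:1] of f is repelling. -/
theorem stmt_9 :
    F (1, 1) = (1, 1) ∧
    fderiv ℝ F (1, 1) = (-2 : ℝ) • ContinuousLinearMap.id ℝ (ℝ × ℝ) := by
  refine ⟨by norm_num [F], HasFDerivAt.fderiv ?_⟩
  have h1 : HasFDerivAt (fun p : ℝ × ℝ => p.1) (ContinuousLinearMap.fst ℝ ℝ ℝ) (1, 1) :=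
    hasFDerivAt_fst
  have h2 : HasFDerivAt (fun p : ℝ × ℝ => p.2) (ContinuousLinearMap.snd ℝ ℝ ℝ) (1, 1) :=
    hasFDerivAt_snd
  have hd := ((h1.add h2).sub_const 1).pow 2
  have hA := (h1.pow 2).mul (((h1.neg.add h2).add_const 1).pow 2)
  have hB := (h2.pow 2).mul (((h1.sub h2).add_const 1).pow 2)
  have hi := (hasDerivAt_inv (x := (((1 : ℝ) + 1 - 1) ^ 2)) (by norm_num)).comp_hasFDerivAt
    ((1, 1) : ℝ × ℝ) hd
  have h := (hA.mul hi).prodMk (hB.mul hi)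
  have hF : HasFDerivAt F _ (1, 1) := h.congr_of_eventuallyEq
    (Filter.Eventually.of_forall fun p => by simp [F, div_eq_mul_inv])
  refine hF.congr_fderiv ?_
  ext <;> simp <;> norm_num
end

section
/- For every (x,y) ∈ ℂ² with x+y ≠ 1 one has the identity ( ∂F₁/∂x · ∂F₂/∂y − ∂F₁/∂y · ∂F₂/∂x )(x,y) · x · y = 4 · F₁(x,y) · F₂(x,y). (This is the statement f*η = 4η that the rational map f of ℙ² multiplies the meromorphic two-form η = dx∧dy/(xy) by the factor 4.) -/
/-- First component of the affine-chart representation of f = g∘h. -/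
noncomputable def F1 (p : ℂ × ℂ) : ℂ :=
  p.1 ^ 2 * (-p.1 + p.2 + 1) ^ 2 / (p.1 + p.2 - 1) ^ 2
/-- Second component of the affine-chart representation of f = g∘h. -/
noncomputable def F2 (p : ℂ × ℂ) : ℂ :=
  p.2 ^ 2 * (p.1 - p.2 + 1) ^ 2 / (p.1 + p.2 - 1) ^ 2

lemma aux_dir (F : ℂ × ℂ → ℂ) (p v : ℂ × ℂ) (d : ℂ) (hF : DifferentiableAt ℂ F p)
    (h : HasDerivAt (fun t : ℂ => F (p.1 + t * v.1, p.2 + t * v.2)) d 0) :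
    fderiv ℂ F p v = d := by
  have h2 : HasLineDerivAt ℂ F d p v := by
    unfold HasLineDerivAt
    exact h
  exact (hF.hasFDerivAt.hasLineDerivAt v).unique h2

lemma aux_line (c a : ℂ) : HasDerivAt (fun t : ℂ => c + t * a) a 0 := by
  simpa using ((hasDerivAt_id (0 : ℂ)).mul_const a).const_add c

lemma aux_F1 (p v : ℂ × ℂ) (hp : p.1 + p.2 - 1 ≠ 0) :
    fderiv ℂ F1 p v =
      ((2 * p.1 * v.1 * (-p.1 + p.2 + 1) ^ 2
        + p.1 ^ 2 * (2 * (-p.1 + p.2 + 1) * (-v.1 + v.2))) * (p.1 + p.2 - 1) ^ 2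
        - p.1 ^ 2 * (-p.1 + p.2 + 1) ^ 2 * (2 * (p.1 + p.2 - 1) * (v.1 + v.2)))
        / ((p.1 + p.2 - 1) ^ 2) ^ 2 := by
  apply aux_dir
  · unfold F1
    have : (p.1 + p.2 - 1) ^ 2 ≠ 0 := pow_ne_zero 2 hp
    fun_prop (disch := assumption)
  · have hx := aux_line p.1 v.1
    have hy := aux_line p.2 v.2
    have h := ((hx.pow 2).mul (((hx.neg.add hy).add_const 1).pow 2)).div
      (((hx.add hy).sub_const 1).pow 2) (by simpa using hp)
    refine h.congr_deriv ?_
    simp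

lemma aux_F2 (p v : ℂ × ℂ) (hp : p.1 + p.2 - 1 ≠ 0) :
    fderiv ℂ F2 p v =
      ((2 * p.2 * v.2 * (p.1 - p.2 + 1) ^ 2
        + p.2 ^ 2 * (2 * (p.1 - p.2 + 1) * (v.1 - v.2))) * (p.1 + p.2 - 1) ^ 2
        - p.2 ^ 2 * (p.1 - p.2 + 1) ^ 2 * (2 * (p.1 + p.2 - 1) * (v.1 + v.2)))
        / ((p.1 + p.2 - 1) ^ 2) ^ 2 := by
  apply aux_dir
  · unfold F2
    have : (p.1 + p.2 - 1) ^ 2 ≠ 0 := pow_ne_zero 2 hp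
    fun_prop (disch := assumption)
  · have hx := aux_line p.1 v.1
    have hy := aux_line p.2 v.2
    have h := ((hy.pow 2).mul (((hx.sub hy).add_const 1).pow 2)).div
      (((hx.add hy).sub_const 1).pow 2) (by simpa using hp)
    refine h.congr_deriv ?_
    simp

/-- The Jacobian identity (∂F₁/∂x·∂F₂/∂y − ∂F₁/∂y·∂F₂/∂x)·x·y = 4·F₁·F₂,
i.e. f*η = 4η for the two-form η = dx∧dy/(xy). -/
theorem stmt_11 (p : ℂ × ℂ) (hp : p.1 + p.2 ≠ 1) :
    (fderiv ℂ F1 p (1, 0) * fderiv ℂ F2 p (0, 1)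
      - fderiv ℂ F1 p (0, 1) * fderiv ℂ F2 p (1, 0)) * p.1 * p.2
      = 4 * F1 p * F2 p := by
  have hd : p.1 + p.2 - 1 ≠ 0 := sub_ne_zero.mpr hp
  rw [aux_F1 p _ hd, aux_F1 p _ hd, aux_F2 p _ hd, aux_F2 p _ hd, F1, F2]
  obtain ⟨x, y⟩ := p
  simp only at hd ⊢
  field_simp
  ring
end

section
/- Let μ be the Borel measure on ℝ² with density (1/(2π²))·(1/(xy))·1_U with respect to Lebesgue measure. Then for every Borel set A ⊆ U one has μ({p ∈ U : p₁ + p₂ ≠ 1 and F(p) ∈ A}) = μ(A); that is, μ is an invariant measure for the map F (equivalently, for the rational map f of ℙ²). -/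
open MeasureTheory

/-- U = {(x,y) ∈ ℝ² : x² + y² + 1 − 2(xy + x + y) < 0}. -/
def U : Set (ℝ × ℝ) :=
  {p | p.1 ^ 2 + p.2 ^ 2 + 1 - 2 * (p.1 * p.2 + p.1 + p.2) < 0}

/-- The measure with density (1/(2π²))·(1/(xy))·1_U w.r.t. Lebesgue measure. -/
noncomputable def mu : Measure (ℝ × ℝ) :=
  volume.withDensity
    (U.indicator fun p => ENNReal.ofReal (1 / (2 * Real.pi ^ 2) * (1 / (p.1 * p.2))))


noncomputable def Phi (t : ℝ × ℝ) : ℝ × ℝ :=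
  (Real.sin t.1 ^ 2 / Real.sin (t.1 + t.2) ^ 2, Real.sin t.2 ^ 2 / Real.sin (t.1 + t.2) ^ 2)

def Tri : Set (ℝ × ℝ) := {t | 0 < t.1 ∧ 0 < t.2 ∧ t.1 + t.2 < Real.pi}

lemma tri_meas : MeasurableSet Tri := by
  unfold Tri
  refine (measurableSet_lt measurable_const measurable_fst).inter
    ((measurableSet_lt measurable_const measurable_snd).inter
      (measurableSet_lt (measurable_fst.add measurable_snd) measurable_const))

lemma U_meas : MeasurableSet U := by
  unfold U
  exact measurableSet_lt (by fun_prop) (by fun_prop)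

lemma Phi_meas : Measurable Phi := by
  unfold Phi
  fun_prop

lemma F_meas : Measurable F := by
  unfold F
  fun_prop

lemma tri_sin {t : ℝ × ℝ} (ht : t ∈ Tri) :
    0 < Real.sin t.1 ∧ 0 < Real.sin t.2 ∧ 0 < Real.sin (t.1 + t.2) := by
  obtain ⟨h1, h2, h3⟩ := ht
  refine ⟨Real.sin_pos_of_pos_of_lt_pi ?_ ?_, Real.sin_pos_of_pos_of_lt_pi ?_ ?_,
    Real.sin_pos_of_pos_of_lt_pi ?_ ?_⟩ <;> linarith

/-- law of cosines -/
lemma loc (a b : ℝ) :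
    Real.sin b ^ 2 + Real.sin (a + b) ^ 2 - Real.sin a ^ 2
      = 2 * Real.sin b * Real.sin (a + b) * Real.cos a := by
  rw [Real.sin_add]
  have ha := Real.sin_sq_add_cos_sq a
  have hb := Real.sin_sq_add_cos_sq b
  linear_combination (-Real.sin b ^ 2) * ha + (Real.sin a ^ 2) * hb

lemma loc' (a b : ℝ) :
    Real.sin a ^ 2 + Real.sin (a + b) ^ 2 - Real.sin b ^ 2
      = 2 * Real.sin a * Real.sin (a + b) * Real.cos b := by
  rw [add_comm a b]; exact loc b a

lemma loc'' (a b : ℝ) :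
    Real.sin a ^ 2 + Real.sin b ^ 2 - Real.sin (a + b) ^ 2
      = - (2 * Real.sin a * Real.sin b * Real.cos (a + b)) := by
  rw [Real.sin_add, Real.cos_add]
  have ha := Real.sin_sq_add_cos_sq a
  have hb := Real.sin_sq_add_cos_sq b
  linear_combination (-Real.sin b ^ 2) * ha - (Real.sin a ^ 2) * hb

lemma Phi_mem {t : ℝ × ℝ} (ht : t ∈ Tri) : Phi t ∈ U := by
  obtain ⟨h1, h2, h3⟩ := tri_sin ht
  have hl := loc t.1 t.2
  have ha := Real.sin_sq_add_cos_sq t.1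
  simp only [U, Phi, Set.mem_ofPred_eq]
  set s1 := Real.sin t.1
  set s2 := Real.sin t.2
  set s3 := Real.sin (t.1 + t.2)
  have : (s1 ^ 2 / s3 ^ 2) ^ 2 + (s2 ^ 2 / s3 ^ 2) ^ 2 + 1 -
      2 * (s1 ^ 2 / s3 ^ 2 * (s2 ^ 2 / s3 ^ 2) + s1 ^ 2 / s3 ^ 2 + s2 ^ 2 / s3 ^ 2)
      = - (4 * s1 ^ 2 * s2 ^ 2 / s3 ^ 2) := by
    field_simp
    linear_combination (s2 ^ 2 + s3 ^ 2 - s1 ^ 2 + 2 * s2 * s3 * Real.cos t.1) * hl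
      + 4 * s2 ^ 2 * s3 ^ 2 * ha
  rw [this]
  have : 0 < 4 * s1 ^ 2 * s2 ^ 2 / s3 ^ 2 := by positivity
  linarith

lemma Phi_inj : Set.InjOn Phi Tri := by
  intro t ht u hu h
  obtain ⟨h1, h2, h3⟩ := tri_sin ht
  obtain ⟨k1, k2, k3⟩ := tri_sin hu
  have e1 := loc t.1 t.2
  have e2 := loc' t.1 t.2
  have f1 := loc u.1 u.2
  have f2 := loc' u.1 u.2
  simp only [Phi, Prod.mk.injEq, ← div_pow] at h
  obtain ⟨ha, hb⟩ := h
  have ha := (pow_left_inj₀ (by positivity) (by positivity) two_ne_zero).1 ha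
  have hb := (pow_left_inj₀ (by positivity) (by positivity) two_ne_zero).1 hb
  have key : ∀ a b c d : ℝ, 0 < b → 0 < c → b ^ 2 + c ^ 2 - a ^ 2 = 2 * b * c * d →
      d = ((b / c) ^ 2 + 1 - (a / c) ^ 2) / (2 * (b / c)) := by
    intro a b c d hb hc h
    field_simp
    linarith
  have c1 : Real.cos t.1 = Real.cos u.1 := by
    rw [key _ _ _ _ h2 h3 e1, key _ _ _ _ k2 k3 f1, ha, hb]
  have c2 : Real.cos t.2 = Real.cos u.2 := by
    rw [key _ _ _ _ h1 h3 e2, key _ _ _ _ k1 k3 f2, ha, hb]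
  obtain ⟨p1, p2, p3⟩ := ht
  obtain ⟨q1, q2, q3⟩ := hu
  exact Prod.ext
    (Real.injOn_cos ⟨p1.le, by linarith⟩ ⟨q1.le, by linarith⟩ c1)
    (Real.injOn_cos ⟨p2.le, by linarith⟩ ⟨q2.le, by linarith⟩ c2)

lemma U_pos {p : ℝ × ℝ} (hp : p ∈ U) : 0 < p.1 ∧ 0 < p.2 := by
  simp only [U, Set.mem_ofPred_eq] at hp
  constructor
  · nlinarith [sq_nonneg (p.2 - p.1 - 1), sq_nonneg (p.1 - p.2 - 1), sq_nonneg (p.1 + p.2 - 1)]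
  · nlinarith [sq_nonneg (p.2 - p.1 - 1), sq_nonneg (p.1 - p.2 - 1), sq_nonneg (p.1 + p.2 - 1)]

lemma Phi_surj {p : ℝ × ℝ} (hp : p ∈ U) : ∃ t ∈ Tri, Phi t = p := by
  obtain ⟨hx, hy⟩ := U_pos hp
  obtain ⟨x, y⟩ := p
  simp only [U, Set.mem_ofPred_eq] at hp
  simp only at hx hy
  obtain ⟨a, ha, rfl⟩ : ∃ a : ℝ, 0 < a ∧ a ^ 2 = x := ⟨√x, Real.sqrt_pos.2 hx, Real.sq_sqrt hx.le⟩
  obtain ⟨b, hb, rfl⟩ : ∃ a : ℝ, 0 < a ∧ a ^ 2 = y := ⟨√y, Real.sqrt_pos.2 hy, Real.sq_sqrt hy.le⟩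
  have hr : 0 < (1 - (a - b) ^ 2) * ((a + b) ^ 2 - 1) := by nlinarith
  have hab : (a - b) ^ 2 < 1 := by
    by_contra hc
    push Not at hc
    have : 1 ≤ (a + b) ^ 2 := by nlinarith
    nlinarith
  obtain ⟨cA, hcA⟩ : ∃ c, c = (b ^ 2 + 1 - a ^ 2) / (2 * b) := ⟨_, rfl⟩
  obtain ⟨cB, hcB⟩ : ∃ c, c = (a ^ 2 + 1 - b ^ 2) / (2 * a) := ⟨_, rfl⟩
  obtain ⟨r, hrr⟩ : ∃ r, r = (1 - (a - b) ^ 2) * ((a + b) ^ 2 - 1) := ⟨_, rfl⟩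
  rw [← hrr] at hr
  have sA : 1 - cA ^ 2 = r / (2 * b) ^ 2 := by rw [hcA, hrr]; field_simp; ring
  have sB : 1 - cB ^ 2 = r / (2 * a) ^ 2 := by rw [hcB, hrr]; field_simp; ring
  have pA : 0 < 1 - cA ^ 2 := by rw [sA]; positivity
  have pB : 0 < 1 - cB ^ 2 := by rw [sB]; positivity
  have hA : -1 < cA ∧ cA < 1 := abs_lt.1 ((sq_lt_one_iff_abs_lt_one cA).1 (by linarith))
  have hB : -1 < cB ∧ cB < 1 := abs_lt.1 ((sq_lt_one_iff_abs_lt_one cB).1 (by linarith))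
  have eA := Real.cos_arccos hA.1.le hA.2.le
  have eB := Real.cos_arccos hB.1.le hB.2.le
  have iA : Real.sin (Real.arccos cA) = √r / (2 * b) := by
    rw [Real.sin_arccos, sA, Real.sqrt_div hr.le, Real.sqrt_sq (by positivity)]
  have iB : Real.sin (Real.arccos cB) = √r / (2 * a) := by
    rw [Real.sin_arccos, sB, Real.sqrt_div hr.le, Real.sqrt_sq (by positivity)]
  have iC : Real.sin (Real.arccos cA + Real.arccos cB) = √r / (2 * a * b) := by
    rw [Real.sin_add, eA, eB, iA, iB, hcA, hcB]
    field_simp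
    ring
  have hsr : 0 < √r := Real.sqrt_pos.2 hr
  refine ⟨(Real.arccos cA, Real.arccos cB), ⟨Real.arccos_pos.2 hA.2, Real.arccos_pos.2 hB.2, ?_⟩, ?_⟩
  · have : -cB < cA := by
      have : cA + cB = (a + b) * (1 - (a - b) ^ 2) / (2 * a * b) := by
        rw [hcA, hcB]; field_simp; ring
      have : 0 < cA + cB := by
        rw [this]
        have : 0 < 1 - (a - b) ^ 2 := by linarith
        positivity
      linarith
    have h := Real.arccos_lt_arccos (by linarith) this hA.2.le
    rw [Real.arccos_neg] at h
    show Real.arccos cA + Real.arccos cB < Real.pi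
    linarith
  · simp only [Phi, iA, iB, iC, Prod.mk.injEq]
    constructor <;> field_simp

lemma F_Phi {t : ℝ × ℝ} (ht : t ∈ Tri) (hc : Real.cos (t.1 + t.2) ≠ 0) :
    F (Phi t) = Phi (2 * t.1, 2 * t.2) := by
  obtain ⟨h1, h2, h3⟩ := tri_sin ht
  have e1 := loc t.1 t.2
  have e2 := loc' t.1 t.2
  have e3 := loc'' t.1 t.2
  simp only [F, Phi, ← mul_add, Real.sin_two_mul]
  set s1 := Real.sin t.1
  set s2 := Real.sin t.2
  set s3 := Real.sin (t.1 + t.2)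
  have g1 : -(s1 ^ 2 / s3 ^ 2) + s2 ^ 2 / s3 ^ 2 + 1 = 2 * s2 * s3 * Real.cos t.1 / s3 ^ 2 := by
    rw [← e1]; field_simp; ring
  have g2 : s1 ^ 2 / s3 ^ 2 - s2 ^ 2 / s3 ^ 2 + 1 = 2 * s1 * s3 * Real.cos t.2 / s3 ^ 2 := by
    rw [← e2]; field_simp; ring
  have g3 : s1 ^ 2 / s3 ^ 2 + s2 ^ 2 / s3 ^ 2 - 1
      = -(2 * s1 * s2 * Real.cos (t.1 + t.2)) / s3 ^ 2 := by
    rw [← e3]; field_simp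
  rw [g1, g2, g3]
  ext <;> simp only <;> field_simp

lemma Phi_sum {t : ℝ × ℝ} (ht : t ∈ Tri) :
    (Phi t).1 + (Phi t).2 ≠ 1 ↔ Real.cos (t.1 + t.2) ≠ 0 := by
  obtain ⟨h1, h2, h3⟩ := tri_sin ht
  have e3 := loc'' t.1 t.2
  have : (Phi t).1 + (Phi t).2 - 1 =
      -(2 * Real.sin t.1 * Real.sin t.2 * Real.cos (t.1 + t.2)) / Real.sin (t.1 + t.2) ^ 2 := by
    rw [← e3]; simp only [Phi]; field_simp
  rw [← sub_ne_zero, this]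
  simp [h1.ne', h2.ne', h3.ne']

noncomputable def dPhi (t : ℝ × ℝ) : ℝ × ℝ →L[ℝ] ℝ × ℝ :=
  (Matrix.toLin (Module.Basis.finTwoProd ℝ) (Module.Basis.finTwoProd ℝ)
    !![2 * Real.sin t.1 * Real.cos t.1 / Real.sin (t.1 + t.2) ^ 2
        - 2 * Real.sin t.1 ^ 2 * Real.cos (t.1 + t.2) / Real.sin (t.1 + t.2) ^ 3,
      - 2 * Real.sin t.1 ^ 2 * Real.cos (t.1 + t.2) / Real.sin (t.1 + t.2) ^ 3;
      - 2 * Real.sin t.2 ^ 2 * Real.cos (t.1 + t.2) / Real.sin (t.1 + t.2) ^ 3,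
      2 * Real.sin t.2 * Real.cos t.2 / Real.sin (t.1 + t.2) ^ 2
        - 2 * Real.sin t.2 ^ 2 * Real.cos (t.1 + t.2) / Real.sin (t.1 + t.2) ^ 3]).toContinuousLinearMap

lemma dPhi_det {t : ℝ × ℝ} (ht : t ∈ Tri) : (dPhi t).det = 4 * ((Phi t).1 * (Phi t).2) := by
  obtain ⟨h1, h2, h3⟩ := tri_sin ht
  have hs := Real.sin_add t.1 t.2
  have hc := Real.cos_add t.1 t.2
  simp only [dPhi, LinearMap.det_toContinuousLinearMap, LinearMap.det_toLin,
    Matrix.det_fin_two_of, Phi]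
  field_simp
  linear_combination (4 * Real.sin (t.1 + t.2) * Real.cos (t.1 + t.2)) * hs - (4 * Real.sin (t.1 + t.2) ^ 2) * hc

lemma Phi_deriv {t : ℝ × ℝ} (ht : t ∈ Tri) : HasFDerivAt Phi (dPhi t) t := by
  obtain ⟨h1, h2, h3⟩ := tri_sin ht
  have d1 : HasFDerivAt (fun p : ℝ × ℝ => Real.sin p.1)
      (Real.cos t.1 • ContinuousLinearMap.fst ℝ ℝ ℝ) t :=
    (Real.hasDerivAt_sin t.1).comp_hasFDerivAt t (hasFDerivAt_fst (𝕜 := ℝ) (p := t))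
  have d2 : HasFDerivAt (fun p : ℝ × ℝ => Real.sin p.2)
      (Real.cos t.2 • ContinuousLinearMap.snd ℝ ℝ ℝ) t :=
    (Real.hasDerivAt_sin t.2).comp_hasFDerivAt t (hasFDerivAt_snd (𝕜 := ℝ) (p := t))
  have d0 : HasFDerivAt (fun p : ℝ × ℝ => p.1 + p.2)
      (ContinuousLinearMap.fst ℝ ℝ ℝ + ContinuousLinearMap.snd ℝ ℝ ℝ) t :=
    HasFDerivAt.fun_add (hasFDerivAt_fst (𝕜 := ℝ) (p := t)) (hasFDerivAt_snd (𝕜 := ℝ) (p := t))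
  have d4 : HasFDerivAt (fun p : ℝ × ℝ => Real.sin (p.1 + p.2))
      (Real.cos (t.1 + t.2) •
        (ContinuousLinearMap.fst ℝ ℝ ℝ + ContinuousLinearMap.snd ℝ ℝ ℝ)) t := d0.sin
  have d3 : HasFDerivAt (fun p : ℝ × ℝ => (Real.sin (p.1 + p.2))⁻¹)
      ((-(Real.sin (t.1 + t.2) ^ 2)⁻¹) • Real.cos (t.1 + t.2) •
        (ContinuousLinearMap.fst ℝ ℝ ℝ + ContinuousLinearMap.snd ℝ ℝ ℝ)) t :=
    (hasDerivAt_inv h3.ne').comp_hasFDerivAt t d4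
  have D := ((d1.mul d3).pow 2).prodMk ((d2.mul d3).pow 2)
  have hfun : Phi = fun p : ℝ × ℝ => ((Real.sin p.1 * (Real.sin (p.1 + p.2))⁻¹) ^ 2,
      (Real.sin p.2 * (Real.sin (p.1 + p.2))⁻¹) ^ 2) := by
    funext p
    simp only [Phi, ← div_eq_mul_inv, div_pow]
  rw [hfun]
  refine D.congr_fderiv ?_
  rw [dPhi, Matrix.toLin_finTwoProd_toContinuousLinearMap]
  ext <;> simp <;> field_simp <;> ring

lemma mu_eq {E : Set (ℝ × ℝ)} (hE : MeasurableSet E) (hEU : E ⊆ U) :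
    mu E = ENNReal.ofReal (2 / Real.pi ^ 2) * volume (Tri ∩ Phi ⁻¹' E) := by
  have hm : MeasurableSet (Tri ∩ Phi ⁻¹' E) := tri_meas.inter (Phi_meas hE)
  have him : Phi '' (Tri ∩ Phi ⁻¹' E) = E := by
    ext p
    constructor
    · rintro ⟨t, ⟨_, h⟩, rfl⟩; exact h
    · intro hp
      obtain ⟨t, ht, rfl⟩ := Phi_surj (hEU hp)
      exact ⟨t, ⟨ht, hp⟩, rfl⟩
  rw [mu, withDensity_apply _ hE]
  have : ∫⁻ p in E, U.indicator
      (fun p => ENNReal.ofReal (1 / (2 * Real.pi ^ 2) * (1 / (p.1 * p.2)))) p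
      = ∫⁻ p in E, ENNReal.ofReal (1 / (2 * Real.pi ^ 2) * (1 / (p.1 * p.2))) := by
    refine setLIntegral_congr_fun hE fun p hp => ?_
    rw [Set.indicator_of_mem (hEU hp)]
  rw [this]
  conv_lhs => rw [← him]
  rw [lintegral_image_eq_lintegral_abs_det_fderiv_mul volume hm
    (fun t ht => (Phi_deriv ht.1).hasFDerivWithinAt) (Phi_inj.mono Set.inter_subset_left),
    ← setLIntegral_const]
  refine setLIntegral_congr_fun hm fun t ht => ?_
  obtain ⟨h1, h2⟩ := U_pos (Phi_mem ht.1)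
  rw [dPhi_det ht.1, ← ENNReal.ofReal_mul (abs_nonneg _), abs_of_pos (by positivity)]
  congr 1
  have := Real.pi_pos
  field_simp
  norm_num

lemma vol_aff (r : ℝ) (hr : r ^ 2 = 4) (v : ℝ × ℝ) (S : Set (ℝ × ℝ)) :
    volume ((fun t : ℝ × ℝ => r • t + v) ⁻¹' S) = ENNReal.ofReal (1 / 4) * volume S := by
  have h0 : r ≠ 0 := by rintro rfl; norm_num at hr
  have : (fun t : ℝ × ℝ => r • t + v) ⁻¹' S = (r • ·) ⁻¹' ((· + v) ⁻¹' S) := rfl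
  rw [this, Measure.addHaar_preimage_smul _ h0, measure_preimage_add_right]
  congr 2
  simp [hr]

lemma Phi_neg (t : ℝ × ℝ) : Phi (-t) = Phi t := by
  simp only [Phi, Prod.fst_neg, Prod.snd_neg, ← neg_add, Real.sin_neg, neg_sq]

lemma Phi_p1 (a b : ℝ) : Phi (a - Real.pi, b) = Phi (a, b) := by
  simp only [Phi]
  rw [show a - Real.pi + b = a + b - Real.pi by ring, Real.sin_sub_pi, Real.sin_sub_pi, neg_sq, neg_sq]

lemma Phi_p2 (a b : ℝ) : Phi (a, b - Real.pi) = Phi (a, b) := by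
  simp only [Phi]
  rw [show a + (b - Real.pi) = a + b - Real.pi by ring, Real.sin_sub_pi, Real.sin_sub_pi, neg_sq, neg_sq]

theorem stmt_14 (A : Set (ℝ × ℝ)) (hA : MeasurableSet A) (hAU : A ⊆ U) :
    mu {p | p ∈ U ∧ p.1 + p.2 ≠ 1 ∧ F p ∈ A} = mu A := by
  have hpre : MeasurableSet {p | p ∈ U ∧ p.1 + p.2 ≠ 1 ∧ F p ∈ A} := by
    refine U_meas.inter (MeasurableSet.inter ?_ (F_meas hA))
    exact (measurableSet_eq_fun (measurable_fst.add measurable_snd) measurable_const).compl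
  rw [mu_eq hpre (fun p hp => hp.1), mu_eq hA hAU]
  congr 1
  set S := Tri ∩ Phi ⁻¹' A with hS
  have hSm : MeasurableSet S := tri_meas.inter (Phi_meas hA)
  set P1 := (fun t : ℝ × ℝ => (2 : ℝ) • t + (0, 0)) ⁻¹' S with hP1
  set P2 := (fun t : ℝ × ℝ => (2 : ℝ) • t + (-Real.pi, 0)) ⁻¹' S with hP2
  set P3 := (fun t : ℝ × ℝ => (2 : ℝ) • t + (0, -Real.pi)) ⁻¹' S with hP3
  set P4 := (fun t : ℝ × ℝ => (-2 : ℝ) • t + (Real.pi, Real.pi)) ⁻¹' S with hP4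
  have m2 : MeasurableSet P2 := (by fun_prop : Measurable _) hSm
  have m3 : MeasurableSet P3 := (by fun_prop : Measurable _) hSm
  have m4 : MeasurableSet P4 := (by fun_prop : Measurable _) hSm
  have hpi := Real.pi_pos
  have q1 : ∀ t, t ∈ P1 ↔ (0 < t.1 ∧ 0 < t.2 ∧ t.1 + t.2 < Real.pi / 2)
      ∧ Phi (2 * t.1, 2 * t.2) ∈ A := by
    intro t
    have : (2 : ℝ) • t + (0, 0) = (2 * t.1, 2 * t.2) := by ext <;> simp
    simp only [hP1, hS, Set.mem_preimage, Set.mem_inter_iff, this, Tri, Set.mem_ofPred_eq]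
    refine and_congr_left' ⟨?_, ?_⟩ <;> rintro ⟨h1, h2, h3⟩ <;> refine ⟨?_, ?_, ?_⟩ <;> linarith
  have q2 : ∀ t, t ∈ P2 ↔ (Real.pi / 2 < t.1 ∧ 0 < t.2 ∧ t.1 + t.2 < Real.pi)
      ∧ Phi (2 * t.1, 2 * t.2) ∈ A := by
    intro t
    have : (2 : ℝ) • t + (-Real.pi, 0) = (2 * t.1 - Real.pi, 2 * t.2) := by
      ext <;> simp <;> ring
    simp only [hP2, hS, Set.mem_preimage, Set.mem_inter_iff, this, Phi_p1, Tri, Set.mem_ofPred_eq]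
    refine and_congr_left' ⟨?_, ?_⟩ <;> rintro ⟨h1, h2, h3⟩ <;> refine ⟨?_, ?_, ?_⟩ <;> linarith
  have q3 : ∀ t, t ∈ P3 ↔ (0 < t.1 ∧ Real.pi / 2 < t.2 ∧ t.1 + t.2 < Real.pi)
      ∧ Phi (2 * t.1, 2 * t.2) ∈ A := by
    intro t
    have : (2 : ℝ) • t + (0, -Real.pi) = (2 * t.1, 2 * t.2 - Real.pi) := by
      ext <;> simp <;> ring
    simp only [hP3, hS, Set.mem_preimage, Set.mem_inter_iff, this, Phi_p2, Tri, Set.mem_ofPred_eq]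
    refine and_congr_left' ⟨?_, ?_⟩ <;> rintro ⟨h1, h2, h3⟩ <;> refine ⟨?_, ?_, ?_⟩ <;> linarith
  have q4 : ∀ t, t ∈ P4 ↔ (t.1 < Real.pi / 2 ∧ t.2 < Real.pi / 2 ∧ Real.pi / 2 < t.1 + t.2)
      ∧ Phi (2 * t.1, 2 * t.2) ∈ A := by
    intro t
    have : (-2 : ℝ) • t + (Real.pi, Real.pi) = -(2 * t.1 - Real.pi, 2 * t.2 - Real.pi) := by
      ext <;> simp <;> ring
    have h' : Phi (-(2 * t.1 - Real.pi, 2 * t.2 - Real.pi)) = Phi (2 * t.1, 2 * t.2) := by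
      rw [Phi_neg, Phi_p1, Phi_p2]
    simp only [hP4, hS, Set.mem_preimage, Set.mem_inter_iff, this, h', Tri, Set.mem_ofPred_eq,
      Prod.fst_neg, Prod.snd_neg]
    refine and_congr_left' ⟨?_, ?_⟩ <;> rintro ⟨h1, h2, h3⟩ <;> refine ⟨?_, ?_, ?_⟩ <;> linarith
  have hun : Tri ∩ Phi ⁻¹' {p | p ∈ U ∧ p.1 + p.2 ≠ 1 ∧ F p ∈ A} = ((P1 ∪ P2) ∪ P3) ∪ P4 := by
    ext t
    simp only [Set.mem_union, q1, q2, q3, q4, Set.mem_inter_iff, Set.mem_preimage,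
      Set.mem_ofPred_eq, ← or_and_right]
    constructor
    · rintro ⟨ht, hU, hs, hF⟩
      have hc := (Phi_sum ht).1 hs
      rw [F_Phi ht hc] at hF
      refine ⟨?_, hF⟩
      obtain ⟨p1, p2⟩ := U_pos (hAU hF)
      have n3 : t.1 + t.2 ≠ Real.pi / 2 := by
        intro h; rw [h] at hc; exact hc Real.cos_pi_div_two
      have n1 : t.1 ≠ Real.pi / 2 := by
        intro h
        simp [Phi, h, mul_div_cancel₀] at p1
      have n2 : t.2 ≠ Real.pi / 2 := by
        intro h
        simp [Phi, h, mul_div_cancel₀] at p2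
      obtain ⟨h1, h2, h3⟩ := ht
      rcases lt_or_gt_of_ne n1 with k1 | k1
      · rcases lt_or_gt_of_ne n2 with k2 | k2
        · rcases lt_or_gt_of_ne n3 with k3 | k3
          · exact Or.inl (Or.inl (Or.inl ⟨h1, h2, k3⟩))
          · exact Or.inr ⟨k1, k2, k3⟩
        · exact Or.inl (Or.inr ⟨h1, k2, h3⟩)
      · exact Or.inl (Or.inl (Or.inr ⟨k1, h2, h3⟩))
    · rintro ⟨h, hF⟩
      have ht : t ∈ Tri ∧ t.1 + t.2 ≠ Real.pi / 2 := by
        rcases h with ((⟨h1, h2, h3⟩ | ⟨h1, h2, h3⟩) | ⟨h1, h2, h3⟩) | ⟨h1, h2, h3⟩ <;>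
        refine ⟨⟨?_, ?_, ?_⟩, ?_⟩ <;> first | linarith | (apply ne_of_lt; linarith) |
          (apply ne_of_gt; linarith)
      obtain ⟨ht, hne⟩ := ht
      have hc : Real.cos (t.1 + t.2) ≠ 0 := by
        intro h0
        apply hne
        obtain ⟨h1, h2, h3⟩ := ht
        refine Real.injOn_cos ⟨by linarith, h3.le⟩ ⟨by linarith, by linarith⟩ ?_
        rw [h0, Real.cos_pi_div_two]
      exact ⟨ht, Phi_mem ht, (Phi_sum ht).2 hc, by rw [F_Phi ht hc]; exact hF⟩
  rw [hun, measure_union _ m4, measure_union _ m3, measure_union _ m2,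
    vol_aff 2 (by norm_num), vol_aff 2 (by norm_num), vol_aff 2 (by norm_num),
    vol_aff (-2) (by norm_num), ← add_mul, ← add_mul, ← add_mul,
    ← ENNReal.ofReal_add (by norm_num) (by norm_num),
    ← ENNReal.ofReal_add (by norm_num) (by norm_num),
    ← ENNReal.ofReal_add (by norm_num) (by norm_num)]
  · norm_num
  · rw [Set.disjoint_left]
    intro t h h'
    rw [q1] at h; rw [q2] at h'
    linarith [h.1.1, h.1.2.1, h.1.2.2, h'.1.1]
  · rw [Set.disjoint_left]
    intro t h h'
    rw [Set.mem_union, q1, q2] at h; rw [q3] at h'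
    rcases h with h | h <;> linarith [h.1.1, h.1.2.1, h.1.2.2, h'.1.1, h'.1.2.1]
  · rw [Set.disjoint_left]
    intro t h h'
    rw [Set.mem_union, Set.mem_union, q1, q2, q3] at h; rw [q4] at h'
    rcases h with (h | h) | h <;> linarith [h.1.1, h.1.2.1, h.1.2.2, h'.1.1, h'.1.2.1, h'.1.2.2]
end

section
/- For every real z one has N′(z)·D(z) − N(z)·D′(z) ≠ 0, where N(z) = −z(5z³ − 12z² + 6z − 4) and D(z) = 4z³ − 6z² + 12z − 5. Equivalently, the rational function r = N/D has no real critical points: its six critical points (counted with multiplicity) come in complex-conjugate pairs, none of which lies on the real line. -/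
/-- Numerator N(z) = −z(5z³ − 12z² + 6z − 4). -/
def N (z : ℝ) : ℝ := -z * (5 * z ^ 3 - 12 * z ^ 2 + 6 * z - 4)
/-- Denominator D(z) = 4z³ − 6z² + 12z − 5. -/
def D (z : ℝ) : ℝ := 4 * z ^ 3 - 6 * z ^ 2 + 12 * z - 5

/-- N′D − ND′ has no real zeros: r = N/D has no real critical points. -/
theorem stmt_16 (z : ℝ) : deriv N z * D z - N z * deriv D z ≠ 0 := by
  have hN : HasDerivAt N (-20 * z ^ 3 + 36 * z ^ 2 - 12 * z + 4) z := by
    have h := ((hasDerivAt_id z).neg).mul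
      ((((((hasDerivAt_id z).pow 3).const_mul 5).sub (((hasDerivAt_id z).pow 2).const_mul 12)).add
        ((hasDerivAt_id z).const_mul 6)).sub_const 4)
    refine h.congr_deriv ?_
    simp
    ring
  have hD : HasDerivAt D (12 * z ^ 2 - 12 * z + 12) z := by
    have h := (((((hasDerivAt_id z).pow 3).const_mul 4).sub
      (((hasDerivAt_id z).pow 2).const_mul 6)).add
        ((hasDerivAt_id z).const_mul 12)).sub_const 5
    refine h.congr_deriv ?_
    simp
    ring
  rw [hN.deriv, hD.deriv]
  have key : 0 < 5 * z ^ 6 - 15 * z ^ 5 + 57 * z ^ 4 - 89 * z ^ 3 + 57 * z ^ 2 - 15 * z + 5 := by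
    rcases lt_or_ge 0 z with hz | hz
    · have e : 5 * z ^ 6 - 15 * z ^ 5 + 57 * z ^ 4 - 89 * z ^ 3 + 57 * z ^ 2 - 15 * z + 5
          = 5 * z ^ 3 + 42 * z ^ 2 * (z - 1) ^ 2 + 15 * z * ((z - 1) ^ 2) ^ 2
            + 5 * ((z - 1) ^ 2) ^ 3 := by ring
      rw [e]
      positivity
    · obtain ⟨y, rfl⟩ : ∃ y, z = -y := ⟨-z, by ring⟩
      have hy : 0 ≤ y := by linarith
      have e : 5 * (-y) ^ 6 - 15 * (-y) ^ 5 + 57 * (-y) ^ 4 - 89 * (-y) ^ 3 + 57 * (-y) ^ 2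
          - 15 * (-y) + 5
          = 5 * y ^ 6 + 15 * y ^ 5 + 57 * y ^ 4 + 89 * y ^ 3 + 57 * y ^ 2 + 15 * y + 5 := by ring
      rw [e]
      positivity
  unfold N D
  intro h
  nlinarith [h, key]
end

section
/- Let U₀ = {(x,y) ∈ ℝ² : −x+y+1 > 0, x−y+1 > 0, x+y−1 > 0}, U₁ = U ∩ {−x+y+1 < 0}, U₂ = U ∩ {x−y+1 < 0}, U₃ = U ∩ {x+y−1 < 0}. Then U₀, U₁, U₂, U₃ are pairwise disjoint open subsets of U, the map F is defined on each of them (x+y ≠ 1 there), and for each j ∈ {0,1,2,3} the restriction of F to U_j is a bijection from U_j onto U. (This is the statement that f maps each of the four pieces of the partition of the invariant region U by the three exceptional lines homeomorphically onto U.) -/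
/-- The central triangle U₀ = {−x+y+1 > 0, x−y+1 > 0, x+y−1 > 0}. -/
def U0 : Set (ℝ × ℝ) :=
  {p | 0 < -p.1 + p.2 + 1 ∧ 0 < p.1 - p.2 + 1 ∧ 0 < p.1 + p.2 - 1}
/-- U₁ = U ∩ {−x+y+1 < 0}. -/
def U1 : Set (ℝ × ℝ) := U ∩ {p | -p.1 + p.2 + 1 < 0}
/-- U₂ = U ∩ {x−y+1 < 0}. -/
def U2 : Set (ℝ × ℝ) := U ∩ {p | p.1 - p.2 + 1 < 0}
/-- U₃ = U ∩ {x+y−1 < 0}. -/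
def U3 : Set (ℝ × ℝ) := U ∩ {p | p.1 + p.2 - 1 < 0}

/-- The pieces of the partition of U by the exceptional lines. -/
def Upart : Fin 4 → Set (ℝ × ℝ) := ![U0, U1, U2, U3]

/-- The affine form of h. -/
noncomputable def Hmap (p : ℝ × ℝ) : ℝ × ℝ :=
  (p.1 * (-p.1 + p.2 + 1) / (p.1 + p.2 - 1), p.2 * (p.1 - p.2 + 1) / (p.1 + p.2 - 1))

/-- The affine form of g. -/
def Sq (p : ℝ × ℝ) : ℝ × ℝ := (p.1 ^ 2, p.2 ^ 2)

theorem F_eq_comp : F = Sq ∘ Hmap := by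
  funext p
  simp only [F, Sq, Hmap, Function.comp, div_pow, mul_pow]

theorem memU_iff (p : ℝ × ℝ) :
    p ∈ U ↔ 0 < (-p.1 + p.2 + 1) * (p.1 - p.2 + 1) + 2 * (p.1 + p.2 - 1) := by
  simp only [U, Set.mem_ofPred_eq]
  constructor <;> intro h <;> nlinarith

theorem H_a (p : ℝ × ℝ) (hc : p.1 + p.2 - 1 ≠ 0) :
    -(Hmap p).1 + (Hmap p).2 + 1 = p.1 - p.2 + 1 := by
  simp only [Hmap]; field_simp; ring

theorem H_b (p : ℝ × ℝ) (hc : p.1 + p.2 - 1 ≠ 0) :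
    (Hmap p).1 - (Hmap p).2 + 1 = -p.1 + p.2 + 1 := by
  simp only [Hmap]; field_simp; ring

theorem H_c (p : ℝ × ℝ) (hc : p.1 + p.2 - 1 ≠ 0) :
    (Hmap p).1 + (Hmap p).2 - 1 =
      (-p.1 + p.2 + 1) * (p.1 - p.2 + 1) / (p.1 + p.2 - 1) := by
  simp only [Hmap]; field_simp; ring

theorem H_H (p : ℝ × ℝ) (ha : -p.1 + p.2 + 1 ≠ 0) (hb : p.1 - p.2 + 1 ≠ 0)
    (hc : p.1 + p.2 - 1 ≠ 0) : Hmap (Hmap p) = p := by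
  have h1 := H_a p hc
  have h2 := H_b p hc
  have h3 := H_c p hc
  have e : Hmap (Hmap p) =
    ((Hmap p).1 * (-(Hmap p).1 + (Hmap p).2 + 1) / ((Hmap p).1 + (Hmap p).2 - 1),
     (Hmap p).2 * ((Hmap p).1 - (Hmap p).2 + 1) / ((Hmap p).1 + (Hmap p).2 - 1)) := rfl
  rw [e, h1, h2, h3]
  obtain ⟨x, y⟩ := p
  simp only [Hmap] at *
  ext
  · simp only
    generalize -x + y + 1 = a at *
    generalize x - y + 1 = b at *
    generalize x + y - 1 = c at *
    field_simp
  · simp only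
    generalize -x + y + 1 = a at *
    generalize x - y + 1 = b at *
    generalize x + y - 1 = c at *
    field_simp

def D1 : Set (ℝ × ℝ) := {p | p.1 - p.2 + 1 < 0 ∧ p.1 + p.2 - 1 < 0 ∧ 0 < p.1 + p.2 - 1 + 2}
def D2 : Set (ℝ × ℝ) := {p | -p.1 + p.2 + 1 < 0 ∧ p.1 + p.2 - 1 < 0 ∧ 0 < p.1 + p.2 - 1 + 2}
def D3 : Set (ℝ × ℝ) := {p | 0 < -p.1 + p.2 + 1 ∧ 0 < p.1 - p.2 + 1 ∧ p.1 + p.2 - 1 + 2 < 0}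

theorem U1_signs {p : ℝ × ℝ} (h : p ∈ U1) :
    -p.1 + p.2 + 1 < 0 ∧ 0 < p.1 - p.2 + 1 ∧ 0 < p.1 + p.2 - 1 := by
  obtain ⟨h1, h2⟩ := h
  rw [memU_iff] at h1
  simp only [Set.mem_ofPred_eq] at h2
  have hb : 0 < p.1 - p.2 + 1 := by linarith
  refine ⟨h2, hb, ?_⟩
  nlinarith [mul_neg_of_neg_of_pos h2 hb]

theorem U2_signs {p : ℝ × ℝ} (h : p ∈ U2) :
    0 < -p.1 + p.2 + 1 ∧ p.1 - p.2 + 1 < 0 ∧ 0 < p.1 + p.2 - 1 := by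
  obtain ⟨h1, h2⟩ := h
  rw [memU_iff] at h1
  simp only [Set.mem_ofPred_eq] at h2
  have hb : 0 < -p.1 + p.2 + 1 := by linarith
  refine ⟨hb, h2, ?_⟩
  nlinarith [mul_neg_of_pos_of_neg hb h2]

theorem U3_signs {p : ℝ × ℝ} (h : p ∈ U3) :
    0 < -p.1 + p.2 + 1 ∧ 0 < p.1 - p.2 + 1 ∧ p.1 + p.2 - 1 < 0 := by
  obtain ⟨h1, h2⟩ := h
  rw [memU_iff] at h1
  simp only [Set.mem_ofPred_eq] at h2
  have hab : 0 < (-p.1 + p.2 + 1) * (p.1 - p.2 + 1) := by linarith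
  rcases mul_pos_iff.1 hab with ⟨ha, hb⟩ | ⟨ha, hb⟩
  · exact ⟨ha, hb, h2⟩
  · linarith

theorem bij_of_inv {A B : Set (ℝ × ℝ)} (h1 : Set.MapsTo Hmap A B) (h2 : Set.MapsTo Hmap B A)
    (hA : ∀ p ∈ A, -p.1 + p.2 + 1 ≠ 0 ∧ p.1 - p.2 + 1 ≠ 0 ∧ p.1 + p.2 - 1 ≠ 0)
    (hB : ∀ p ∈ B, -p.1 + p.2 + 1 ≠ 0 ∧ p.1 - p.2 + 1 ≠ 0 ∧ p.1 + p.2 - 1 ≠ 0) :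
    Set.BijOn Hmap A B :=
  Set.InvOn.bijOn
    ⟨fun p hp => H_H p (hA p hp).1 (hA p hp).2.1 (hA p hp).2.2,
     fun p hp => H_H p (hB p hp).1 (hB p hp).2.1 (hB p hp).2.2⟩ h1 h2

theorem H_U (p : ℝ × ℝ) (hc : p.1 + p.2 - 1 ≠ 0)
    (h : 0 < (-p.1 + p.2 + 1) * (p.1 - p.2 + 1) / (p.1 + p.2 - 1) * (p.1 + p.2 - 1 + 2)) :
    Hmap p ∈ U := by
  rw [memU_iff, H_a p hc, H_b p hc, H_c p hc]
  convert h using 1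
  field_simp

theorem H_c2 (p : ℝ × ℝ) (hc : p.1 + p.2 - 1 ≠ 0) :
    (Hmap p).1 + (Hmap p).2 - 1 + 2 =
      ((-p.1 + p.2 + 1) * (p.1 - p.2 + 1) + 2 * (p.1 + p.2 - 1)) / (p.1 + p.2 - 1) := by
  rw [H_c p hc]; field_simp

theorem bijH0 : Set.BijOn Hmap U0 U0 := by
  have hm : Set.MapsTo Hmap U0 U0 := by
    rintro p ⟨ha, hb, hc⟩
    refine ⟨?_, ?_, ?_⟩
    · rw [H_a p hc.ne']; exact hb
    · rw [H_b p hc.ne']; exact ha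
    · rw [H_c p hc.ne']; exact div_pos (mul_pos ha hb) hc
  have hn : ∀ p ∈ U0, -p.1 + p.2 + 1 ≠ 0 ∧ p.1 - p.2 + 1 ≠ 0 ∧ p.1 + p.2 - 1 ≠ 0 := by
    rintro p ⟨ha, hb, hc⟩
    exact ⟨ha.ne', hb.ne', hc.ne'⟩
  exact bij_of_inv hm hm hn hn

theorem bijH1 : Set.BijOn Hmap U1 D1 := by
  refine bij_of_inv ?_ ?_ ?_ ?_
  · intro p hp
    obtain ⟨ha, hb, hc⟩ := U1_signs hp
    refine ⟨?_, ?_, ?_⟩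
    · rw [H_b p hc.ne']; exact ha
    · rw [H_c p hc.ne']; exact div_neg_of_neg_of_pos (mul_neg_of_neg_of_pos ha hb) hc
    · rw [H_c2 p hc.ne']; exact div_pos ((memU_iff p).1 hp.1) hc
  · rintro p ⟨hb, hc, hd⟩
    have ha : 0 < -p.1 + p.2 + 1 := by linarith
    refine ⟨H_U p hc.ne (mul_pos (div_pos_of_neg_of_neg (mul_neg_of_pos_of_neg ha hb) hc) hd), ?_⟩
    simp only [Set.mem_ofPred_eq]
    rw [H_a p hc.ne]; exact hb
  · intro p hp
    obtain ⟨ha, hb, hc⟩ := U1_signs hp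
    exact ⟨ha.ne, hb.ne', hc.ne'⟩
  · rintro p ⟨hb, hc, hd⟩
    have ha : 0 < -p.1 + p.2 + 1 := by linarith
    exact ⟨ha.ne', hb.ne, hc.ne⟩

theorem bijH2 : Set.BijOn Hmap U2 D2 := by
  refine bij_of_inv ?_ ?_ ?_ ?_
  · intro p hp
    obtain ⟨ha, hb, hc⟩ := U2_signs hp
    refine ⟨?_, ?_, ?_⟩
    · rw [H_a p hc.ne']; exact hb
    · rw [H_c p hc.ne']; exact div_neg_of_neg_of_pos (mul_neg_of_pos_of_neg ha hb) hc
    · rw [H_c2 p hc.ne']; exact div_pos ((memU_iff p).1 hp.1) hc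
  · rintro p ⟨ha, hc, hd⟩
    have hb : 0 < p.1 - p.2 + 1 := by linarith
    refine ⟨H_U p hc.ne (mul_pos (div_pos_of_neg_of_neg (mul_neg_of_neg_of_pos ha hb) hc) hd), ?_⟩
    simp only [Set.mem_ofPred_eq]
    rw [H_b p hc.ne]; exact ha
  · intro p hp
    obtain ⟨ha, hb, hc⟩ := U2_signs hp
    exact ⟨ha.ne', hb.ne, hc.ne'⟩
  · rintro p ⟨ha, hc, hd⟩
    have hb : 0 < p.1 - p.2 + 1 := by linarith
    exact ⟨ha.ne, hb.ne', hc.ne⟩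

theorem bijH3 : Set.BijOn Hmap U3 D3 := by
  refine bij_of_inv ?_ ?_ ?_ ?_
  · intro p hp
    obtain ⟨ha, hb, hc⟩ := U3_signs hp
    refine ⟨?_, ?_, ?_⟩
    · rw [H_a p hc.ne]; exact hb
    · rw [H_b p hc.ne]; exact ha
    · rw [H_c2 p hc.ne]; exact div_neg_of_pos_of_neg ((memU_iff p).1 hp.1) hc
  · rintro p ⟨ha, hb, hd⟩
    have hc : p.1 + p.2 - 1 < 0 := by linarith
    have hq := div_neg_of_pos_of_neg (mul_pos ha hb) hc
    refine ⟨H_U p hc.ne (mul_pos_of_neg_of_neg hq hd), ?_⟩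
    simp only [Set.mem_ofPred_eq]
    rw [H_c p hc.ne]; exact hq
  · intro p hp
    obtain ⟨ha, hb, hc⟩ := U3_signs hp
    exact ⟨ha.ne', hb.ne', hc.ne⟩
  · rintro p ⟨ha, hb, hd⟩
    have hc : p.1 + p.2 - 1 < 0 := by linarith
    exact ⟨ha.ne', hb.ne', hc.ne⟩

theorem Sq_mem (p : ℝ × ℝ) (h : 0 < ((-p.1 + p.2 + 1) * (p.1 - p.2 + 1)) *
    ((p.1 + p.2 - 1) * (p.1 + p.2 - 1 + 2))) : Sq p ∈ U := by
  simp only [U, Sq, Set.mem_ofPred_eq]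
  nlinarith

theorem U_sqrt {q : ℝ × ℝ} (hq : q ∈ U) :
    ∃ r w : ℝ, q = (r ^ 2, w ^ 2) ∧ 0 < -r + w + 1 ∧ 0 < r - w + 1 ∧ 0 < r + w - 1 := by
  obtain ⟨u, v⟩ := q
  simp only [U, Set.mem_ofPred_eq] at hq
  have huv : 0 < u * v := by nlinarith [sq_nonneg (u + v - 1)]
  have hs : 0 < u + v := by nlinarith [sq_nonneg (u - v)]
  have hu : 0 < u := by
    rcases mul_pos_iff.1 huv with ⟨h, _⟩ | ⟨h, h'⟩
    · exact h
    · linarith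
  have hv : 0 < v := (mul_pos_iff_of_pos_left hu).1 huv
  have hr := Real.sqrt_pos.2 hu
  have hw := Real.sqrt_pos.2 hv
  have er := Real.sq_sqrt hu.le
  have ew := Real.sq_sqrt hv.le
  refine ⟨√u, √v, by rw [er, ew], ?_⟩
  generalize √u = r at *
  generalize √v = w at *
  subst er ew
  have key : 0 < (r + w + 1) * ((-r + w + 1) * (r - w + 1) * (r + w - 1)) := by nlinarith
  have key2 := (mul_pos_iff_of_pos_left (by positivity : 0 < r + w + 1)).1 key
  rcases mul_pos_iff.1 key2 with ⟨h, hc⟩ | ⟨h, hc⟩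
  · rcases mul_pos_iff.1 h with ⟨ha, hb⟩ | ⟨ha, hb⟩
    · exact ⟨ha, hb, hc⟩
    · linarith
  · rcases mul_neg_iff.1 h with ⟨ha, hb⟩ | ⟨ha, hb⟩ <;> linarith

theorem Sq_inj {p q : ℝ × ℝ} (h : Sq p = Sq q) (h1 : 0 < p.1 * q.1) (h2 : 0 < p.2 * q.2) :
    p = q := by
  simp only [Sq, Prod.mk.injEq] at h
  ext
  · rcases sq_eq_sq_iff_eq_or_eq_neg.1 h.1 with e | e
    · exact e
    · rw [e] at h1; nlinarith [sq_nonneg q.1]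
  · rcases sq_eq_sq_iff_eq_or_eq_neg.1 h.2 with e | e
    · exact e
    · rw [e] at h2; nlinarith [sq_nonneg q.2]

theorem bijS0 : Set.BijOn Sq U0 U := by
  refine ⟨?_, ?_, ?_⟩
  · rintro p ⟨ha, hb, hc⟩
    exact Sq_mem p (by positivity)
  · rintro p ⟨ha, hb, hc⟩ q ⟨ha', hb', hc'⟩ h
    exact Sq_inj h (mul_pos (by linarith) (by linarith)) (mul_pos (by linarith) (by linarith))
  · intro q hq
    obtain ⟨r, w, rfl, ha, hb, hc⟩ := U_sqrt hq
    exact ⟨(r, w), ⟨ha, hb, hc⟩, rfl⟩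

theorem bijS1 : Set.BijOn Sq D1 U := by
  refine ⟨?_, ?_, ?_⟩
  · rintro p ⟨hb, hc, hd⟩
    have ha : 0 < -p.1 + p.2 + 1 := by linarith
    exact Sq_mem p (mul_pos_of_neg_of_neg (mul_neg_of_pos_of_neg ha hb)
      (mul_neg_of_neg_of_pos hc hd))
  · rintro p ⟨ha, hb, hc⟩ q ⟨ha', hb', hc'⟩ h
    exact Sq_inj h (mul_pos_of_neg_of_neg (by linarith) (by linarith))
      (mul_pos (by linarith) (by linarith))
  · intro q hq
    obtain ⟨r, w, rfl, ha, hb, hc⟩ := U_sqrt hq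
    refine ⟨(-r, w), ⟨?_, ?_, ?_⟩, ?_⟩
    · simp only; linarith
    · simp only; linarith
    · simp only; linarith
    · simp [Sq]

theorem bijS2 : Set.BijOn Sq D2 U := by
  refine ⟨?_, ?_, ?_⟩
  · rintro p ⟨ha, hc, hd⟩
    have hb : 0 < p.1 - p.2 + 1 := by linarith
    exact Sq_mem p (mul_pos_of_neg_of_neg (mul_neg_of_neg_of_pos ha hb)
      (mul_neg_of_neg_of_pos hc hd))
  · rintro p ⟨ha, hb, hc⟩ q ⟨ha', hb', hc'⟩ h
    exact Sq_inj h (mul_pos (by linarith) (by linarith))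
      (mul_pos_of_neg_of_neg (by linarith) (by linarith))
  · intro q hq
    obtain ⟨r, w, rfl, ha, hb, hc⟩ := U_sqrt hq
    refine ⟨(r, -w), ⟨?_, ?_, ?_⟩, ?_⟩
    · simp only; linarith
    · simp only; linarith
    · simp only; linarith
    · simp [Sq]

theorem bijS3 : Set.BijOn Sq D3 U := by
  refine ⟨?_, ?_, ?_⟩
  · rintro p ⟨ha, hb, hd⟩
    have hc : p.1 + p.2 - 1 < 0 := by linarith
    exact Sq_mem p (mul_pos (mul_pos ha hb) (mul_pos_of_neg_of_neg hc hd))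
  · rintro p ⟨ha, hb, hc⟩ q ⟨ha', hb', hc'⟩ h
    exact Sq_inj h (mul_pos_of_neg_of_neg (by linarith) (by linarith))
      (mul_pos_of_neg_of_neg (by linarith) (by linarith))
  · intro q hq
    obtain ⟨r, w, rfl, ha, hb, hc⟩ := U_sqrt hq
    refine ⟨(-r, -w), ⟨?_, ?_, ?_⟩, ?_⟩
    · simp only; linarith
    · simp only; linarith
    · simp only; linarith
    · simp [Sq]

theorem isOpen_U : IsOpen U := isOpen_lt (by fun_prop) (by fun_prop)

theorem U0_sub : U0 ⊆ U := by
  rintro p ⟨ha, hb, hc⟩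
  rw [memU_iff]
  positivity

theorem forall_fin4 {P : Fin 4 → Prop} (h0 : P 0) (h1 : P 1) (h2 : P 2) (h3 : P 3) :
    ∀ i, P i := by
  intro i
  fin_cases i <;> assumption

/-- The four pieces are disjoint open subsets of U, F is defined on each, and
F maps each piece bijectively onto U. -/
theorem stmt_18 :
    (∀ i j : Fin 4, i ≠ j → Disjoint (Upart i) (Upart j)) ∧
    (∀ i, IsOpen (Upart i)) ∧
    (∀ i, Upart i ⊆ U) ∧
    (∀ i, ∀ p ∈ Upart i, p.1 + p.2 ≠ 1) ∧
    (∀ i, Set.BijOn F (Upart i) U) := by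
  have s0 : ∀ p ∈ Upart 0, 0 < -p.1 + p.2 + 1 ∧ 0 < p.1 - p.2 + 1 ∧ 0 < p.1 + p.2 - 1 :=
    fun p hp => hp
  have s1 : ∀ p ∈ Upart 1, -p.1 + p.2 + 1 < 0 ∧ 0 < p.1 - p.2 + 1 ∧ 0 < p.1 + p.2 - 1 :=
    fun p hp => U1_signs hp
  have s2 : ∀ p ∈ Upart 2, 0 < -p.1 + p.2 + 1 ∧ p.1 - p.2 + 1 < 0 ∧ 0 < p.1 + p.2 - 1 :=
    fun p hp => U2_signs hp
  have s3 : ∀ p ∈ Upart 3, 0 < -p.1 + p.2 + 1 ∧ 0 < p.1 - p.2 + 1 ∧ p.1 + p.2 - 1 < 0 :=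
    fun p hp => U3_signs hp
  refine ⟨?_, ?_, ?_, ?_, ?_⟩
  · have key : ∀ i j : Fin 4, i ≠ j → ∀ p, p ∈ Upart i → p ∈ Upart j → False := by
      refine forall_fin4 ?_ ?_ ?_ ?_ <;> refine forall_fin4 ?_ ?_ ?_ ?_ <;> intro hne p hi hj
      all_goals first
        | exact hne rfl
        | (first
            | have ti := s0 p hi
            | have ti := s1 p hi
            | have ti := s2 p hi
            | have ti := s3 p hi)
          (first
            | have tj := s0 p hj
            | have tj := s1 p hj
            | have tj := s2 p hj
            | have tj := s3 p hj)
          obtain ⟨_, _, _⟩ := ti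
          obtain ⟨_, _, _⟩ := tj
          linarith
    intro i j hne
    exact Set.disjoint_left.2 fun p hi hj => key i j hne p hi hj
  · refine forall_fin4 ?_ ?_ ?_ ?_
    · change IsOpen ({p : ℝ × ℝ | 0 < -p.1 + p.2 + 1} ∩
        ({p : ℝ × ℝ | 0 < p.1 - p.2 + 1} ∩ {p : ℝ × ℝ | 0 < p.1 + p.2 - 1}))
      exact (isOpen_lt (by fun_prop) (by fun_prop)).inter
        ((isOpen_lt (by fun_prop) (by fun_prop)).inter (isOpen_lt (by fun_prop) (by fun_prop)))
    · exact isOpen_U.inter (isOpen_lt (by fun_prop) (by fun_prop))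
    · exact isOpen_U.inter (isOpen_lt (by fun_prop) (by fun_prop))
    · exact isOpen_U.inter (isOpen_lt (by fun_prop) (by fun_prop))
  · exact forall_fin4 U0_sub Set.inter_subset_left Set.inter_subset_left Set.inter_subset_left
  · refine forall_fin4 ?_ ?_ ?_ ?_ <;> intro p hp h
    · linarith [(s0 p hp).2.2]
    · linarith [(s1 p hp).2.2]
    · linarith [(s2 p hp).2.2]
    · linarith [(s3 p hp).2.2]
  · rw [F_eq_comp]
    exact forall_fin4 (bijS0.comp bijH0) (bijS1.comp bijH1) (bijS2.comp bijH2) (bijS3.comp bijH3)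
end
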